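/- Let Γ be a finite group and n ≥ 1. Then (G_n, K_n) is a Gelfand pair if and only if for every irreducible representation π = π_{ℓ1} ⊗̂ ⋯ ⊗̂ π_{ℓn} of Γ^n and every irreducible representation ρ of S_π, the coefficient ⟨M_π, χ_ρ⟩_{S_π} is at most 1. -/

import Mathlib

noncomputable section

open CategoryTheory
open scoped TensorProduct MonoidalCategory

/-- The action of `Equiv.Perm (Fin n)` on `Fin n → Γ` permuting the factors. -/
def permHom (Γ : Type) [Group Γ] (n : ℕ) : Equiv.Perm (Fin n) →* MulAut (Fin n → Γ) where
  toFun σ :=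
    { toFun := fun f => f ∘ σ.symm
      invFun := fun f => f ∘ σ
      left_inv := fun f => by ext i; simp
      right_inv := fun f => by ext i; simp
      map_mul' := fun f g => rfl }
  map_one' := by ext f i; rfl
  map_mul' := fun σ τ => by ext f i; rfl

/-- The wreath product `Γ^n ⋊ S_n`. -/
abbrev Gn (Γ : Type) [Group Γ] (n : ℕ) := (Fin n → Γ) ⋊[permHom Γ n] Equiv.Perm (Fin n)

/-- The subgroup `K_n = Δ_n × S_n` of `G_n`, where `Δ_n` is the diagonal subgroup of `Γ^n`. -/
def Kn (Γ : Type) [Group Γ] (n : ℕ) : Subgroup (Gn Γ n) where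
  carrier := {g | ∃ γ : Γ, g.left = fun _ => γ}
  one_mem' := ⟨1, rfl⟩
  mul_mem' := by
    rintro a b ⟨γ, ha⟩ ⟨δ, hb⟩
    exact ⟨γ * δ, by simp [SemidirectProduct.mul_left, ha, hb, permHom]; rfl⟩
  inv_mem' := by
    rintro a ⟨γ, ha⟩
    exact ⟨γ⁻¹, by simp [SemidirectProduct.inv_left, ha, permHom]; rfl⟩

instance {N G : Type*} [Group N] [Group G] {φ : G →* MulAut N} [Fintype N] [Fintype G] :
    Fintype (N ⋊[φ] G) :=
  Fintype.ofEquiv (N × G)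
    { toFun := fun p => ⟨p.1, p.2⟩
      invFun := fun s => (s.left, s.right)
      left_inv := fun p => rfl
      right_inv := fun s => rfl }

/-- Convolution product on complex-valued functions on a finite group. -/
def conv {G : Type*} [Group G] [Fintype G] (f g : G → ℂ) : G → ℂ :=
  fun x => (Fintype.card G : ℂ)⁻¹ * ∑ y : G, f (x * y⁻¹) * g y

/-- A function on `G` is `K`-bi-invariant. -/
def IsBiinvariant {G : Type*} [Group G] (K : Subgroup G) (f : G → ℂ) : Prop :=
  ∀ k₁ ∈ K, ∀ k₂ ∈ K, ∀ x : G, f (k₁ * x * k₂) = f x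

/-- `(G, K)` is a Gelfand pair if the convolution algebra of `K`-bi-invariant
complex-valued functions on `G` is commutative. -/
def IsGelfandPair (G : Type*) [Group G] [Fintype G] (K : Subgroup G) : Prop :=
  ∀ f g : G → ℂ, IsBiinvariant K f → IsBiinvariant K g → conv f g = conv g f
open scoped TensorProduct MonoidalCategory

/-- The stabilizer `S_π ⊆ S_n` of the labelled family `π_{ℓ1} ⊗̂ ⋯ ⊗̂ π_{ℓn}`, i.e. the
subgroup of permutations fixing the labelling function `ℓ`. -/
def stab {n : ℕ} {S : Type} (ℓ : Fin n → S) : Subgroup (Equiv.Perm (Fin n)) where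
  carrier := {σ | ∀ i, ℓ (σ i) = ℓ i}
  one_mem' := fun _ => rfl
  mul_mem' := by
    intro a b ha hb i
    simpa [Equiv.Perm.mul_apply, hb i] using ha (b i)
  inv_mem' := by
    intro a ha i
    simpa using (ha (a⁻¹ i)).symm

/-- Transport along an equality of labels. -/
def castLEquiv {Γ S : Type} [Group Γ] (π : S → FDRep ℂ Γ) {s t : S} (h : s = t) :
    (π s : Type) ≃ₗ[ℂ] (π t : Type) := by
  subst h; exact LinearEquiv.refl ℂ (π s)

/-- The intertwining operator `ω(σ)` on `V_1 ⊗ ⋯ ⊗ V_n`, sending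
`v_1 ⊗ ⋯ ⊗ v_n` to `v_{σ⁻¹(1)} ⊗ ⋯ ⊗ v_{σ⁻¹(n)}`. -/
def permOp {Γ S : Type} [Group Γ] {n : ℕ} (π : S → FDRep ℂ Γ) (ℓ : Fin n → S)
    (σ : stab ℓ) : (⨂[ℂ] i, (π (ℓ i) : Type)) →ₗ[ℂ] ⨂[ℂ] i, (π (ℓ i) : Type) :=
  ((PiTensorProduct.reindex ℂ (fun i => (π (ℓ i) : Type)) (σ : Equiv.Perm (Fin n))).trans
    (PiTensorProduct.congr fun i =>
      castLEquiv π (((stab ℓ).inv_mem σ.2) i))).toLinearMap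

/-- The character `χ_{π∘ω}` of the representation `π ∘ ω` of `Γ^n ⋊ S_π` on
`V_1 ⊗ ⋯ ⊗ V_n`, given by `(g, σ) ↦ trace (π(g) ∘ ω(σ))`. -/
def chiPiOmega {Γ S : Type} [Group Γ] {n : ℕ} (π : S → FDRep ℂ Γ) (ℓ : Fin n → S)
    (g : Fin n → Γ) (σ : stab ℓ) : ℂ :=
  LinearMap.trace ℂ _
    ((PiTensorProduct.map fun i => (π (ℓ i)).ρ (g i)) ∘ₗ permOp π ℓ σ)

/-- The class function `M_π` on `S_π`:
`M_π(σ) = (1/|Δ_n|) Σ_{δ ∈ Δ_n} χ_{π∘ω}(δ, σ)`, where `Δ_n ≃ Γ` is the diagonal. -/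
def Mpi {Γ S : Type} [Group Γ] [Fintype Γ] {n : ℕ} (π : S → FDRep ℂ Γ) (ℓ : Fin n → S)
    (σ : stab ℓ) : ℂ :=
  (Fintype.card Γ : ℂ)⁻¹ * ∑ γ : Γ, chiPiOmega π ℓ (fun _ => γ) σ

attribute [local instance] Classical.propDecidable
section FDRepLemmas

variable {G : Type} [Group G]

/-- The scalar by which an endomorphism of a simple representation acts. -/
theorem FDRep.exists_smul_id_of_comm (V : FDRep ℂ G) [Simple V] (f : V →ₗ[ℂ] V)
    (hf : ∀ g, f ∘ₗ V.ρ g = V.ρ g ∘ₗ f) : ∃ c : ℂ, f = c • LinearMap.id := by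
  have h := finrank_endomorphism_simple_eq_one ℂ V
  let F : V ⟶ V := FDRep.forget₂HomLinearEquiv V V (Rep.ofHom ⟨f, hf⟩)
  obtain ⟨c, hc⟩ := (finrank_eq_one_iff_of_nonzero' (𝟙 V) (id_nonzero V)).1 h F
  refine ⟨c, ?_⟩
  have := congrArg (fun φ : V ⟶ V => φ.hom.hom.hom) hc
  exact this.symm

theorem FDRep.eq_zero_of_comm (V W : FDRep ℂ G) [Simple V] [Simple W] (h : ¬ Nonempty (V ≅ W))
    (f : V →ₗ[ℂ] W) (hf : ∀ g, f ∘ₗ V.ρ g = W.ρ g ∘ₗ f) : f = 0 := by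
  have h0 := FDRep.finrank_hom_simple_simple V W
  rw [if_neg h] at h0
  let F : V ⟶ W := FDRep.forget₂HomLinearEquiv V W (Rep.ofHom ⟨f, hf⟩)
  have hF : F = 0 := (Module.finrank_zero_iff.1 h0).elim _ _
  exact congrArg (fun φ : V ⟶ W => φ.hom.hom.hom) hF

theorem FDRep.simple_of_isIrreducible [Finite G] {V : Type} [AddCommGroup V] [Module ℂ V]
    [FiniteDimensional ℂ V] (ρ : Representation ℂ G V) [ρ.IsIrreducible] :
    Simple (FDRep.of ρ) := by
  rw [FDRep.simple_iff_end_is_rank_one]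
  rw [← (Representation.linHom.invariantsEquivFDRepHom _ _).finrank_eq]
  exact ((Representation.invariantsEquivIntertwiningMap ρ ρ).finrank_eq).trans
    (Representation.IsIrreducible.finrank_intertwiningMap_self ρ)

open Representation in
/-- A subspace containing the image of every equivariant map from a simple representation to the
subrepresentation `W` contains `W`. -/
theorem Representation.subrepresentation_le_of_simple_range_le [Finite G] {U : Type}
    [AddCommGroup U] [Module ℂ U] [FiniteDimensional ℂ U] {ω : Representation ℂ G U}
    (W : Subrepresentation ω) (N : Submodule ℂ U)
    (h : ∀ (V : FDRep ℂ G), Simple V → ∀ f : V →ₗ[ℂ] U, (∀ g, f ∘ₗ V.ρ g = ω g ∘ₗ f) →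
      (∀ v, f v ∈ W.toSubmodule) → ∀ v, f v ∈ N) :
    W.toSubmodule ≤ N := by
  intro x hx
  have hx' : x ∈ sSup {m : Submodule (MonoidAlgebra ℂ G) ω.asModule |
      IsSimpleModule (MonoidAlgebra ℂ G) m ∧ m ≤ W.asSubmodule} := by
    rw [IsSemisimpleModule.sSup_simples_le]
    exact hx
  let N' : AddSubmonoid ω.asModule := N.toAddSubmonoid
  have key : ∀ m ∈ {m : Submodule (MonoidAlgebra ℂ G) ω.asModule |
      IsSimpleModule (MonoidAlgebra ℂ G) m ∧ m ≤ W.asSubmodule},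
      ∀ y ∈ m, y ∈ N' := by
    rintro m ⟨hm, hmW⟩ y hy
    let S := Subrepresentation.ofSubmodule' m
    have hS : S.toRepresentation.IsIrreducible := by
      rw [irreducible_iff_isSimpleModule_asModule]
      let F : IntertwiningMap S.toRepresentation ω := ⟨S.toSubmodule.subtype, fun g => rfl⟩
      let F' := IntertwiningMap.equivLinearMapAsModule _ _ F
      have hF : Function.Injective F' := Subtype.val_injective
      have hr : LinearMap.range F' = m := by
        ext z
        exact ⟨by rintro ⟨w, rfl⟩; exact w.2, fun hz => ⟨⟨z, hz⟩, rfl⟩⟩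
      exact IsSimpleModule.congr ((LinearEquiv.ofInjective F' hF).trans (LinearEquiv.ofEq _ _ hr))
    exact h _ (FDRep.simple_of_isIrreducible S.toRepresentation) S.toSubmodule.subtype
      (fun g => rfl) (fun v => hmW v.2) ⟨y, hy⟩
  rw [sSup_eq_iSup'] at hx'
  exact Submodule.iSup_induction _ (motive := fun x => x ∈ N') hx' (fun i y hy => key _ i.2 y hy)
    N'.zero_mem (fun _ _ => N'.add_mem)

end FDRepLemmas

section Fourier

/-- The operator `∑ g, f g • τ g` attached to a function `f` and a representation `τ`. -/
def fourierOp {G V : Type*} [Group G] [Fintype G] [AddCommGroup V] [Module ℂ V]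
    (τ : Representation ℂ G V) : (G → ℂ) →ₗ[ℂ] (V →ₗ[ℂ] V) where
  toFun f := ∑ g, f g • τ g
  map_add' f₁ f₂ := by simp [add_smul, Finset.sum_add_distrib]
  map_smul' c f := by simp [mul_smul, Finset.smul_sum]

theorem fourierOp_apply {G V : Type*} [Group G] [Fintype G] [AddCommGroup V] [Module ℂ V]
    (τ : Representation ℂ G V) (f : G → ℂ) : fourierOp τ f = ∑ g, f g • τ g := rfl

theorem comp_fourierOp {G V W : Type*} [Group G] [Fintype G] [AddCommGroup V] [Module ℂ V]
    [AddCommGroup W] [Module ℂ W] {τ : Representation ℂ G V} {υ : Representation ℂ G W}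
    (i : V →ₗ[ℂ] W) (hi : ∀ g, i ∘ₗ τ g = υ g ∘ₗ i) (f : G → ℂ) :
    i ∘ₗ fourierOp τ f = fourierOp υ f ∘ₗ i := by
  ext v
  have hi' (g : G) : i (τ g v) = υ g (i v) := LinearMap.congr_fun (hi g) v
  simp [fourierOp_apply, hi']

/-- The sum of the conjugates of a linear map is equivariant. -/
theorem sum_conj_comm {G V W : Type*} [Group G] [Fintype G] [AddCommGroup V] [Module ℂ V]
    [AddCommGroup W] [Module ℂ W] (τ : Representation ℂ G V) (υ : Representation ℂ G W)
    (X : V →ₗ[ℂ] W) (h : G) :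
    (∑ g, υ g ∘ₗ X ∘ₗ τ g⁻¹) ∘ₗ τ h = υ h ∘ₗ ∑ g, υ g ∘ₗ X ∘ₗ τ g⁻¹ := by
  ext v
  simp only [LinearMap.comp_apply, LinearMap.sum_apply, map_sum]
  refine Fintype.sum_equiv (Equiv.mulLeft h⁻¹) _ _ fun g => ?_
  simp only [Equiv.coe_mulLeft, ← Module.End.mul_apply, ← mul_assoc, ← map_mul]
  simp

theorem FDRep.finrank_ne_zero_of_simple {G : Type} [Group G] (V : FDRep ℂ G) [Simple V] :
    (Module.finrank ℂ V : ℂ) ≠ 0 := by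
  intro h
  have h0 : Subsingleton V := Module.finrank_zero_iff.1 (by exact_mod_cast h)
  apply id_nonzero V
  ext v
  exact h0.elim _ _

theorem FDRep.sum_conj_of_simple {G : Type} [Group G] [Fintype G] (V : FDRep ℂ G) [Simple V]
    (X : V →ₗ[ℂ] V) :
    ∑ g, V.ρ g ∘ₗ X ∘ₗ V.ρ g⁻¹ =
      (Fintype.card G * LinearMap.trace ℂ V X / Module.finrank ℂ V : ℂ) • LinearMap.id := by
  obtain ⟨c, hc⟩ := V.exists_smul_id_of_comm _ (sum_conj_comm V.ρ V.ρ X)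
  have h : ∀ g : G, LinearMap.trace ℂ V (V.ρ g ∘ₗ X ∘ₗ V.ρ g⁻¹) = LinearMap.trace ℂ V X := by
    intro g
    rw [← Module.End.mul_eq_comp, ← Module.End.mul_eq_comp, LinearMap.trace_mul_comm, mul_assoc,
      ← map_mul]
    simp
  have ht := congrArg (LinearMap.trace ℂ V) hc
  simp only [map_sum, h, map_smul, LinearMap.trace_id, Finset.sum_const, Finset.card_univ,
    nsmul_eq_mul, smul_eq_mul] at ht
  rw [hc, ht, mul_div_assoc, div_self V.finrank_ne_zero_of_simple, mul_one]

theorem LinearMap.sum_coord_smulRight {ι V W : Type*} [Fintype ι] [AddCommGroup V] [Module ℂ V]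
    [AddCommGroup W] [Module ℂ W] (b : Module.Basis ι ℂ V) (A : V →ₗ[ℂ] W) :
    ∑ i, (b.coord i).smulRight (A (b i)) = A := by
  refine b.ext fun j => ?_
  simp [LinearMap.sum_apply, Finsupp.single_apply]

variable {Γ S : Type} [Group Γ] [Fintype Γ] (π : S → FDRep ℂ Γ)

/-- Every operator on one member of a family of pairwise non-isomorphic simple representations is
realised by a function whose operators on the other members vanish. -/
theorem exists_fourierOp_eq (hsimple : ∀ s, Simple (π s))
    (hdistinct : ∀ s t : S, Nonempty (π s ≅ π t) → s = t) (s : S)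
    (A : (π s : Type) →ₗ[ℂ] (π s : Type)) :
    ∃ f : Γ → ℂ, fourierOp (π s).ρ f = A ∧ ∀ t, t ≠ s → fourierOp (π t).ρ f = 0 := by
  let D : Submodule ℂ (Γ → ℂ) := ⨅ t : {t // t ≠ s}, LinearMap.ker (fourierOp (π t).ρ)
  suffices h : A ∈ D.map (fourierOp (π s).ρ) by
    obtain ⟨f, hf, hA⟩ := h
    exact ⟨f, hA, fun t ht => (Submodule.mem_iInf _).1 hf ⟨t, ht⟩⟩
  rw [← LinearMap.sum_coord_smulRight (Module.finBasis ℂ (π s : Type)) A]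
  refine Submodule.sum_mem _ fun i _ => ?_
  generalize (Module.finBasis ℂ (π s : Type)).coord i = l
  generalize A (Module.finBasis ℂ (π s : Type) i) = w
  let f : Γ → ℂ := fun g => l ((π s).ρ g⁻¹ w)
  have hf (t : S) (v : (π t : Type)) : fourierOp (π t).ρ f v =
      (∑ g, (π t).ρ g ∘ₗ (l.smulRight v) ∘ₗ (π s).ρ g⁻¹) w := by
    simp [fourierOp_apply, LinearMap.sum_apply, f]
  have hd := (π s).finrank_ne_zero_of_simple
  refine ⟨(Module.finrank ℂ (π s) / Fintype.card Γ : ℂ) • f, D.smul_mem _ ?_, ?_⟩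
  · refine (Submodule.mem_iInf _).2 fun t => ?_
    rw [LinearMap.mem_ker]
    ext v
    rw [hf, FDRep.eq_zero_of_comm (π s) (π t) (fun h => t.2 (hdistinct _ _ h).symm) _
      (sum_conj_comm _ _ _)]
    rfl
  · ext v
    have := Fintype.card_ne_zero (α := Γ)
    rw [map_smul, LinearMap.smul_apply, hf, FDRep.sum_conj_of_simple]
    simp only [LinearMap.trace_smulRight, LinearMap.smul_apply, LinearMap.id_apply, smul_smul,
      LinearMap.smulRight_apply]
    congr 1
    field_simp

/-- The left regular representation on functions. -/
def leftTranslation (Γ : Type) [Group Γ] : Representation ℂ Γ (Γ → ℂ) where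
  toFun g := LinearMap.funLeft ℂ ℂ (fun x => g⁻¹ * x)
  map_one' := by ext; simp
  map_mul' g h := by ext; simp [LinearMap.funLeft_apply, mul_assoc]

theorem eq_zero_of_fourierOp_eq_zero
    (hcomplete : ∀ τ : FDRep ℂ Γ, Simple τ → ∃ s, Nonempty (τ ≅ π s)) (f : Γ → ℂ)
    (hf : ∀ s, fourierOp (π s).ρ f = 0) : f = 0 := by
  have h := Representation.subrepresentation_le_of_simple_range_le
    (⊤ : Subrepresentation (leftTranslation Γ)) (LinearMap.ker (fourierOp (leftTranslation Γ) f))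
    (fun V hV i hi _ v => by
      obtain ⟨s, ⟨e⟩⟩ := hcomplete V hV
      have he : (FDRep.isoToLinearEquiv e).toLinearMap ∘ₗ fourierOp V.ρ f = 0 := by
        rw [comp_fourierOp _ (υ := (π s).ρ) _ f, hf s, LinearMap.zero_comp]
        intro g
        ext v
        simp [FDRep.Iso.conj_ρ e g, LinearEquiv.conj_apply]
      have he' : fourierOp V.ρ f v = 0 :=
        (FDRep.isoToLinearEquiv e).map_eq_zero_iff.1 (LinearMap.congr_fun he v)
      have := LinearMap.congr_fun (comp_fourierOp i hi f) v
      simpa [he'] using this.symm)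
  have h1 := h (Submodule.mem_top (x := Pi.single 1 1))
  rw [LinearMap.mem_ker] at h1
  ext x
  simpa [fourierOp_apply, leftTranslation, Finset.sum_apply, LinearMap.funLeft_apply,
    Pi.single_apply, inv_mul_eq_one] using congrFun h1 x

theorem span_matrixCoeff_eq_top
    (hcomplete : ∀ τ : FDRep ℂ Γ, Simple τ → ∃ s, Nonempty (τ ≅ π s)) :
    Submodule.span ℂ {φ : Γ → ℂ | ∃ (s : S) (l : (π s : Type) →ₗ[ℂ] ℂ) (v : (π s : Type)),
      φ = fun g => l ((π s).ρ g v)} = ⊤ := by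
  by_contra hne
  obtain ⟨F, hF0, hF⟩ := Submodule.exists_le_ker_of_lt_top _ (lt_top_iff_ne_top.2 hne)
  have hFsum (φ : Γ → ℂ) : F φ = ∑ g, F (Pi.single g 1) * φ g := by
    conv_lhs => rw [pi_eq_sum_univ' φ]
    simp [mul_comm]
  apply hF0
  have h0 : (fun g => F (Pi.single g 1)) = 0 := by
    refine eq_zero_of_fourierOp_eq_zero π hcomplete _ fun s => ?_
    ext v
    refine (Module.forall_dual_apply_eq_zero_iff ℂ _).1 fun l => ?_
    have := hF (Submodule.subset_span ⟨s, l, v, rfl⟩)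
    rw [LinearMap.mem_ker, hFsum] at this
    simpa [fourierOp_apply, LinearMap.sum_apply] using this
  ext φ
  have := congrFun h0 φ
  simpa using this

end Fourier

section TensorPower

/-- A multilinear map vanishing on families drawn from spanning sets is zero. -/
theorem MultilinearMap.eq_zero_of_span_eq_top {ι M N : Type*} [Fintype ι] [DecidableEq ι]
    [AddCommGroup M] [Module ℂ M] [AddCommGroup N] [Module ℂ N]
    (F : MultilinearMap ℂ (fun _ : ι => M) N) {C : Set M} (hC : Submodule.span ℂ C = ⊤)
    (h : ∀ φ : ι → M, (∀ i, φ i ∈ C) → F φ = 0) (φ : ι → M) : F φ = 0 := by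
  suffices H : ∀ s : Finset ι, ∀ φ : ι → M, (∀ i, i ∉ s → φ i ∈ C) → F φ = 0 from
    H Finset.univ φ (by simp)
  intro s
  induction s using Finset.induction_on with
  | empty => exact fun φ hφ => h φ fun i => hφ i (Finset.notMem_empty i)
  | insert a s _ ih =>
    intro φ hφ
    have hle : Submodule.span ℂ C ≤ LinearMap.ker (F.toLinearMap φ a) := by
      refine Submodule.span_le.2 fun c hc => ih _ fun i hi => ?_
      rcases eq_or_ne i a with rfl | hia
      · simpa using hc
      · simpa [hia] using hφ i (by simp [hia, hi])
    have := hle (hC ▸ Submodule.mem_top : φ a ∈ _)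
    simpa using this

variable {Γ S : Type} [Group Γ] {n : ℕ} (π : S → FDRep ℂ Γ) (ℓ : Fin n → S)

/-- The exterior tensor product of the representations `π (ℓ i)`. -/
def tensorRep : Representation ℂ (Fin n → Γ) (⨂[ℂ] i, (π (ℓ i) : Type)) :=
  PiTensorProduct.mapMonoidHom.comp (MonoidHom.pi fun i => (π (ℓ i)).ρ.comp (Pi.evalMonoidHom _ i))

theorem tensorRep_apply (g : Fin n → Γ) :
    tensorRep π ℓ g = PiTensorProduct.map fun i => (π (ℓ i)).ρ (g i) := rfl

theorem fourierOp_tensorRep_prod [Fintype Γ] (φ : Fin n → Γ → ℂ) :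
    fourierOp (tensorRep π ℓ) (fun g => ∏ i, φ i (g i)) =
      PiTensorProduct.map fun i => fourierOp (π (ℓ i)).ρ (φ i) := by
  have h := (PiTensorProduct.mapMultilinear ℂ (fun i => (π (ℓ i) : Type))
    (fun i => (π (ℓ i) : Type))).map_sum (fun i g => φ i g • (π (ℓ i)).ρ g)
  simp only [PiTensorProduct.mapMultilinear_apply] at h
  simp only [fourierOp_apply]
  rw [h]
  refine Finset.sum_congr rfl fun g _ => ?_
  exact ((PiTensorProduct.mapMultilinear ℂ (fun i => (π (ℓ i) : Type))
    (fun i => (π (ℓ i) : Type))).map_smul_univ _ _).symm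

theorem eq_zero_of_fourierOp_tensorRep_eq_zero [Fintype Γ]
    (hcomplete : ∀ τ : FDRep ℂ Γ, Simple τ → ∃ s, Nonempty (τ ≅ π s)) (f : (Fin n → Γ) → ℂ)
    (hf : ∀ ℓ : Fin n → S, fourierOp (tensorRep π ℓ) f = 0) : f = 0 := by
  let F : MultilinearMap ℂ (fun _ : Fin n => Γ → ℂ) ℂ :=
    ∑ g, f g • (MultilinearMap.mkPiAlgebra ℂ (Fin n) ℂ).compLinearMap
      (fun i => LinearMap.proj (g i))
  have hF (φ : Fin n → Γ → ℂ) : F φ = ∑ g, f g * ∏ i, φ i (g i) := by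
    simp [F]
  have h0 := F.eq_zero_of_span_eq_top (span_matrixCoeff_eq_top π hcomplete) fun φ hφ => by
    choose ℓ l v hlv using hφ
    let L := PiTensorProduct.lift ((MultilinearMap.mkPiAlgebra ℂ (Fin n) ℂ).compLinearMap l)
    have h := congrArg L (LinearMap.congr_fun (hf ℓ) (PiTensorProduct.tprod ℂ v))
    rw [hF]
    simpa [fourierOp_apply, LinearMap.sum_apply, tensorRep_apply, L, hlv] using h
  ext x
  have hx := h0 fun i => Pi.single (x i) 1
  rw [hF] at hx
  simpa [Pi.single_apply, Fintype.prod_ite_zero, ← funext_iff] using hx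

theorem PiTensorProduct.span_map_eq_top {ι : Type*} [Fintype ι] (V : ι → Type*)
    [∀ i, AddCommGroup (V i)] [∀ i, Module ℂ (V i)] [∀ i, FiniteDimensional ℂ (V i)] :
    Submodule.span ℂ (Set.range fun A : ∀ i, V i →ₗ[ℂ] V i => PiTensorProduct.map A) = ⊤ := by
  refine eq_top_iff.2 fun A _ => ?_
  let b := fun i => Module.finBasis ℂ (V i)
  let B := Basis.piTensorProduct b
  rw [← LinearMap.sum_coord_smulRight B A]
  refine Submodule.sum_mem _ fun p _ => ?_
  have hx : A (B p) ∈ Submodule.span ℂ (Set.range (PiTensorProduct.tprod ℂ (s := V))) := by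
    rw [PiTensorProduct.span_tprod_eq_top]; trivial
  have hle : Submodule.span ℂ (Set.range (PiTensorProduct.tprod ℂ (s := V))) ≤
      (Submodule.span ℂ (Set.range fun A : ∀ i, V i →ₗ[ℂ] V i => PiTensorProduct.map A)).comap
        (LinearMap.smulRightₗ (B.coord p)) := by
    rw [Submodule.span_le]
    rintro _ ⟨y, rfl⟩
    refine Submodule.subset_span ⟨fun i => ((b i).coord (p i)).smulRight (y i), ?_⟩
    ext x
    simp [B, MultilinearMap.map_smul_univ]
  exact hle hx

variable {ℓ} in
theorem not_mem_stab_iff (σ : Equiv.Perm (Fin n)) : σ ∉ stab ℓ ↔ ∃ i, ℓ (σ i) ≠ ℓ i := by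
  change ¬ (∀ i, ℓ (σ i) = ℓ i) ↔ _
  push Not
  rfl

/-- Every operator on the exterior tensor product attached to `ℓ` is realised by a function whose
translates by permutations outside the stabilizer of `ℓ` act by zero. -/
theorem exists_fourierOp_tensorRep_eq [Fintype Γ] (hsimple : ∀ s, Simple (π s))
    (hdistinct : ∀ s t : S, Nonempty (π s ≅ π t) → s = t)
    (A : (⨂[ℂ] i, (π (ℓ i) : Type)) →ₗ[ℂ] ⨂[ℂ] i, (π (ℓ i) : Type)) :
    ∃ f : (Fin n → Γ) → ℂ, fourierOp (tensorRep π ℓ) f = A ∧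
      ∀ σ ∉ stab ℓ, fourierOp (tensorRep π ℓ) (fun g => f (g ∘ σ)) = 0 := by
  let D : Submodule ℂ ((Fin n → Γ) → ℂ) := ⨅ σ : {σ // σ ∉ stab ℓ},
    LinearMap.ker (fourierOp (tensorRep π ℓ) ∘ₗ LinearMap.funLeft ℂ ℂ fun g => g ∘ σ.1)
  suffices h : (⊤ : Submodule ℂ _) ≤ D.map (fourierOp (tensorRep π ℓ)) by
    obtain ⟨f, hf, hA⟩ := h (Submodule.mem_top (x := A))
    exact ⟨f, hA, fun σ hσ => (Submodule.mem_iInf _).1 hf ⟨σ, hσ⟩⟩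
  rw [← PiTensorProduct.span_map_eq_top, Submodule.span_le]
  rintro _ ⟨A, rfl⟩
  choose φ hφ hφ0 using fun i => exists_fourierOp_eq π hsimple hdistinct (ℓ i) (A i)
  refine ⟨fun g => ∏ i, φ i (g i), (Submodule.mem_iInf _).2 fun ⟨σ, hσ⟩ => ?_, ?_⟩
  · obtain ⟨i, hi⟩ := (not_mem_stab_iff _).1 hσ
    have hprod : (fun g : Fin n → Γ => ∏ i, φ i (g (σ i))) =
        fun g => ∏ i, φ (σ.symm i) (g i) := by
      ext g
      exact Fintype.prod_equiv σ _ _ fun i => by simp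
    change fourierOp (tensorRep π ℓ) (fun g : Fin n → Γ => ∏ i, φ i (g (σ i))) = 0
    rw [hprod, fourierOp_tensorRep_prod]
    exact (PiTensorProduct.mapMultilinear ℂ (fun i => (π (ℓ i) : Type))
      (fun i => (π (ℓ i) : Type))).map_coord_zero (σ i) (by
        simpa using hφ0 i (ℓ (σ i)) hi)
  · rw [fourierOp_tensorRep_prod]
    simp only [hφ]

theorem castLEquiv_trans {s t u : S} (h : s = t) (h' : t = u) (v : (π s : Type)) :
    castLEquiv π h' (castLEquiv π h v) = castLEquiv π (h.trans h') v := by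
  subst h h'; rfl

theorem castLEquiv_ρ {s t : S} (h : s = t) (g : Γ) (v : (π s : Type)) :
    castLEquiv π h ((π s).ρ g v) = (π t).ρ g (castLEquiv π h v) := by
  subst h; rfl

theorem permOp_tprod (σ : stab ℓ) (v : ∀ i, (π (ℓ i) : Type)) :
    permOp π ℓ σ (PiTensorProduct.tprod ℂ v) = PiTensorProduct.tprod ℂ fun i =>
      castLEquiv π (((stab ℓ).inv_mem σ.2) i) (v ((σ : Equiv.Perm (Fin n)).symm i)) := by
  rw [permOp, LinearEquiv.coe_coe, LinearEquiv.trans_apply, PiTensorProduct.reindex_tprod]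
  exact PiTensorProduct.congr_tprod _ _

/-- The intertwining representation of the stabilizer. -/
def permRep : Representation ℂ (stab ℓ) (⨂[ℂ] i, (π (ℓ i) : Type)) where
  toFun := permOp π ℓ
  map_one' := by
    ext v
    simp only [LinearMap.compMultilinearMap_apply, permOp_tprod]
    rfl
  map_mul' σ τ := by
    ext v
    simp only [LinearMap.compMultilinearMap_apply, permOp_tprod, Module.End.mul_apply,
      castLEquiv_trans]
    rfl

theorem permRep_comp_tensorRep (σ : stab ℓ) (g : Fin n → Γ) :
    permRep π ℓ σ ∘ₗ tensorRep π ℓ g = tensorRep π ℓ (g ∘ σ.1.symm) ∘ₗ permRep π ℓ σ := by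
  ext v
  simp only [LinearMap.compMultilinearMap_apply, LinearMap.comp_apply, tensorRep_apply,
    PiTensorProduct.map_tprod, permRep, MonoidHom.coe_mk, OneHom.coe_mk, permOp_tprod]
  exact congrArg _ (funext fun i => castLEquiv_ρ π _ _ _)

/-- The representation `(σ, γ) ↦ π(γ, …, γ) ω(σ)` of `S_π × Γ`. -/
def stabDiagRep : Representation ℂ (stab ℓ × Γ) (⨂[ℂ] i, (π (ℓ i) : Type)) where
  toFun x := tensorRep π ℓ (fun _ => x.2) ∘ₗ permRep π ℓ x.1
  map_one' := by
    change tensorRep π ℓ 1 * permRep π ℓ 1 = 1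
    simp
  map_mul' x y := by
    have h1 : tensorRep π ℓ (fun _ => (x * y).2) =
        tensorRep π ℓ (fun _ => x.2) * tensorRep π ℓ (fun _ => y.2) := by
      rw [← map_mul]; rfl
    have h2 : permRep π ℓ x.1 * tensorRep π ℓ (fun _ => y.2) =
        tensorRep π ℓ (fun _ => y.2) * permRep π ℓ x.1 :=
      permRep_comp_tensorRep π ℓ x.1 fun _ => y.2
    simp only [← Module.End.mul_eq_comp]
    rw [h1, Prod.fst_mul, map_mul, mul_assoc, mul_assoc, ← mul_assoc (permRep π ℓ x.1), h2,
      mul_assoc]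

end TensorPower

section Commutant

variable {H Γ U : Type} [Group H] [Group Γ] [AddCommGroup U] [Module ℂ U]

/-- Operators commuting with `H` and bi-invariant under `Γ`. -/
structure IsBiinvariantIntertwiner (ω : Representation ℂ (H × Γ) U) (A : U →ₗ[ℂ] U) : Prop where
  comm : ∀ h, A ∘ₗ ω (h, 1) = ω (h, 1) ∘ₗ A
  left_inv : ∀ γ, ω (1, γ) ∘ₗ A = A
  right_inv : ∀ γ, A ∘ₗ ω (1, γ) = A

variable {ω : Representation ℂ (H × Γ) U}

theorem IsBiinvariantIntertwiner.comp_of_intertwining {V : FDRep ℂ H} {f : V →ₗ[ℂ] U}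
    {r : U →ₗ[ℂ] V} (hf : ∀ x, f ∘ₗ V.ρ.comp (MonoidHom.fst H Γ) x = ω x ∘ₗ f)
    (hr : ∀ x, r ∘ₗ ω x = V.ρ.comp (MonoidHom.fst H Γ) x ∘ₗ r) :
    IsBiinvariantIntertwiner ω (f ∘ₗ r) where
  comm h := by
    rw [LinearMap.comp_assoc, hr, ← LinearMap.comp_assoc, hf, LinearMap.comp_assoc]
  left_inv γ := by
    rw [← LinearMap.comp_assoc, ← hf]
    ext v
    simp
  right_inv γ := by
    rw [LinearMap.comp_assoc, hr]
    ext v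
    simp

variable [Fintype H] [Fintype Γ]

theorem exists_retraction {V : FDRep ℂ H} [Simple V] {f : V →ₗ[ℂ] U}
    (hf : ∀ x, f ∘ₗ V.ρ.comp (MonoidHom.fst H Γ) x = ω x ∘ₗ f) (hf0 : f ≠ 0) :
    ∃ r : U →ₗ[ℂ] V, (∀ x, r ∘ₗ ω x = V.ρ.comp (MonoidHom.fst H Γ) x ∘ₗ r) ∧ r ∘ₗ f ≠ 0 := by
  obtain ⟨v, hv⟩ : ∃ v, f v ≠ 0 := by
    by_contra! h
    exact hf0 (LinearMap.ext h)
  obtain ⟨l, hl⟩ : ∃ l : Module.Dual ℂ U, l (f v) ≠ 0 := by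
    by_contra! h
    exact hv ((Module.forall_dual_apply_eq_zero_iff ℂ _).1 h)
  let τ := V.ρ.comp (MonoidHom.fst H Γ)
  let X : U →ₗ[ℂ] V := l.smulRight v
  refine ⟨∑ x, τ x ∘ₗ X ∘ₗ ω x⁻¹, sum_conj_comm ω τ X, fun h0 => ?_⟩
  have htr (x : H × Γ) : LinearMap.trace ℂ V ((τ x ∘ₗ X ∘ₗ ω x⁻¹) ∘ₗ f) = l (f v) := by
    have h1 : (τ x ∘ₗ X ∘ₗ ω x⁻¹) ∘ₗ f = τ x ∘ₗ (X ∘ₗ f) ∘ₗ τ x⁻¹ := by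
      simp only [LinearMap.comp_assoc]
      rw [← hf]
    rw [h1, LinearMap.trace_comp_comm', LinearMap.comp_assoc, ← Module.End.mul_eq_comp (τ x⁻¹),
      ← map_mul, inv_mul_cancel, map_one, Module.End.one_eq_id, LinearMap.comp_id]
    have h2 : X ∘ₗ f = (l ∘ₗ f).smulRight v := by
      ext w
      simp [X]
    rw [h2, LinearMap.trace_smulRight]
    rfl
  have h2 : ∑ x : H × Γ, (τ x ∘ₗ X ∘ₗ ω x⁻¹) ∘ₗ f = 0 := by
    rw [← h0]
    ext w
    simp
  have h3 := congrArg (LinearMap.trace ℂ V) h2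
  rw [map_sum, Finset.sum_congr rfl fun x _ => htr x] at h3
  simp [hl] at h3

theorem finrank_intertwiningMap_le_one_of_commute
    (h : ∀ A B, IsBiinvariantIntertwiner ω A → IsBiinvariantIntertwiner ω B →
      A ∘ₗ B = B ∘ₗ A) (V : FDRep ℂ H) [Simple V] :
    Module.finrank ℂ (Representation.IntertwiningMap (V.ρ.comp (MonoidHom.fst H Γ)) ω) ≤ 1 := by
  by_cases hF : ∀ F : Representation.IntertwiningMap (V.ρ.comp (MonoidHom.fst H Γ)) ω, F = 0
  · exact finrank_le_one 0 fun F => ⟨0, by simp [hF F]⟩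
  push Not at hF
  obtain ⟨F₁, hF₁⟩ := hF
  have hf₁ := F₁.isIntertwining'
  have hne : F₁.toLinearMap ≠ 0 := fun h =>
    hF₁ (Representation.IntertwiningMap.ext h)
  obtain ⟨r, hr, hr0⟩ := exists_retraction hf₁ hne
  have hscalar (F : Representation.IntertwiningMap (V.ρ.comp (MonoidHom.fst H Γ)) ω) :
      ∃ c : ℂ, r ∘ₗ F.toLinearMap = c • LinearMap.id := by
    refine V.exists_smul_id_of_comm _ fun g => ?_
    have h1 := F.isIntertwining' (g, 1)
    have h2 := hr (g, 1)
    change _ ∘ₗ V.ρ g = _ at h1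
    change _ = V.ρ g ∘ₗ _ at h2
    rw [LinearMap.comp_assoc, h1, ← LinearMap.comp_assoc, h2, LinearMap.comp_assoc]
  obtain ⟨c₁, hc₁⟩ := hscalar F₁
  have hc₁0 : c₁ ≠ 0 := by
    rintro rfl
    simp [hc₁] at hr0
  refine finrank_le_one F₁ fun F₂ => ?_
  obtain ⟨c₂, hc₂⟩ := hscalar F₂
  have hcomm := h _ _ (.comp_of_intertwining hf₁ hr) (.comp_of_intertwining F₂.isIntertwining' hr)
  refine ⟨c₂ / c₁, Representation.IntertwiningMap.ext (LinearMap.ext fun v => ?_)⟩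
  have e₁ (w : V) : r (F₁.toLinearMap w) = c₁ • w := LinearMap.congr_fun hc₁ w
  have e₂ (w : V) : r (F₂.toLinearMap w) = c₂ • w := LinearMap.congr_fun hc₂ w
  have h3 := LinearMap.congr_fun hcomm (F₁.toLinearMap v)
  simp only [LinearMap.comp_apply, e₁, e₂, map_smul, smul_smul] at h3
  have h4 := congrArg (fun u => (c₁ ^ 2)⁻¹ • u) h3
  simp only [smul_smul] at h4
  rw [show (c₁ ^ 2)⁻¹ * (c₁ * c₂) = c₂ / c₁ by field_simp,
    show (c₁ ^ 2)⁻¹ * (c₁ * c₁) = 1 by field_simp, one_smul] at h4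
  exact h4

variable [FiniteDimensional ℂ U]

theorem commute_of_finrank_intertwiningMap_le_one
    (h : ∀ V : FDRep ℂ H, Simple V → Module.finrank ℂ
      (Representation.IntertwiningMap (V.ρ.comp (MonoidHom.fst H Γ)) ω) ≤ 1)
    {A B : U →ₗ[ℂ] U} (hA : IsBiinvariantIntertwiner ω A) (hB : IsBiinvariantIntertwiner ω B) :
    A ∘ₗ B = B ∘ₗ A := by
  let W : Subrepresentation (ω.comp (MonoidHom.inl H Γ)) :=
    { toSubmodule := ⨅ γ : Γ, LinearMap.eqLocus (ω (1, γ)) LinearMap.id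
      apply_mem_toSubmodule := fun g u hu => by
        simp only [Submodule.mem_iInf, LinearMap.mem_eqLocus, LinearMap.id_apply] at hu ⊢
        intro γ
        change ω (1, γ) (ω (g, 1) u) = ω (g, 1) u
        rw [← Module.End.mul_apply, ← map_mul, Prod.mk_mul_mk, one_mul, mul_one]
        nth_rewrite 2 [← hu γ]
        rw [← Module.End.mul_apply, ← map_mul, Prod.mk_mul_mk, one_mul, mul_one] }
  have hW : W.toSubmodule ≤ LinearMap.ker (A ∘ₗ B - B ∘ₗ A) := by
    refine Representation.subrepresentation_le_of_simple_range_le W _ fun V hV f hf hfW v => ?_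
    have hfW' (γ : Γ) (v : V) : ω (1, γ) (f v) = f v := by
      have := hfW v
      simp only [W, Submodule.mem_iInf, LinearMap.mem_eqLocus, LinearMap.id_apply] at this
      exact this γ
    let F (C : U →ₗ[ℂ] U) (hC : ∀ h, C ∘ₗ ω (h, 1) = ω (h, 1) ∘ₗ C)
        (hC' : ∀ γ v, ω (1, γ) (C (f v)) = C (f v)) :
        Representation.IntertwiningMap (V.ρ.comp (MonoidHom.fst H Γ)) ω :=
      ⟨C ∘ₗ f, fun x => by
        ext v
        have h1 : f (V.ρ x.1 v) = ω (x.1, 1) (f v) := LinearMap.congr_fun (hf x.1) v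
        have h2 : ω x = ω (x.1, 1) * ω (1, x.2) := by
          rw [← map_mul, Prod.mk_mul_mk, one_mul, mul_one]
        have h3 := LinearMap.congr_fun (hC x.1) (f v)
        simp only [LinearMap.comp_apply] at h3
        change C (f (V.ρ x.1 v)) = ω x (C (f v))
        rw [h1, h2, Module.End.mul_apply, hC', h3]⟩
    let F₀ := F LinearMap.id (fun _ => rfl) hfW'
    let FA := F A hA.comm fun γ v => LinearMap.congr_fun (hA.left_inv γ) (f v)
    let FB := F B hB.comm fun γ v => LinearMap.congr_fun (hB.left_inv γ) (f v)
    by_cases hF₀ : F₀ = 0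
    · have : f v = 0 := congrArg (fun T => T.toLinearMap v) hF₀
      rw [this]
      exact zero_mem _
    obtain ⟨G, hG⟩ := finrank_le_one_iff.1 (h V hV)
    obtain ⟨c, hc⟩ := hG F₀
    have hc0 : c ≠ 0 := by
      rintro rfl
      exact hF₀ (by rw [← hc, zero_smul])
    have hmul (T) : ∃ a : ℂ, T = a • F₀ := by
      obtain ⟨a, ha⟩ := hG T
      exact ⟨a / c, by rw [← hc, smul_smul, div_mul_cancel₀ _ hc0, ha]⟩
    obtain ⟨a, ha⟩ := hmul FA
    obtain ⟨b, hb⟩ := hmul FB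
    have ha' : A (f v) = a • f v := congrArg (fun T => T.toLinearMap v) ha
    have hb' : B (f v) = b • f v := congrArg (fun T => T.toLinearMap v) hb
    simp [ha', hb', smul_smul, mul_comm]
  ext u
  have hu : ∑ γ : Γ, ω (1, γ) u ∈ W.toSubmodule := by
    simp only [W, Submodule.mem_iInf, LinearMap.mem_eqLocus, LinearMap.id_apply]
    intro δ
    rw [map_sum]
    refine Fintype.sum_equiv (Equiv.mulLeft δ) _ _ fun γ => ?_
    rw [← Module.End.mul_apply, ← map_mul, Prod.mk_mul_mk, one_mul]
    rfl
  have hinv (C D : U →ₗ[ℂ] U) (hD : IsBiinvariantIntertwiner ω D) :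
      C (D (∑ γ : Γ, ω (1, γ) u)) = Fintype.card Γ • C (D u) := by
    have hD' (γ : Γ) : D (ω (1, γ) u) = D u := LinearMap.congr_fun (hD.right_inv γ) u
    simp [map_sum, hD']
  have h0 := hW hu
  rw [LinearMap.mem_ker, LinearMap.sub_apply, LinearMap.comp_apply, LinearMap.comp_apply,
    hinv A B hB, hinv B A hA, sub_eq_zero, ← Nat.cast_smul_eq_nsmul ℂ,
    ← Nat.cast_smul_eq_nsmul ℂ] at h0
  exact smul_right_injective U (Nat.cast_ne_zero.2 Fintype.card_ne_zero) h0

end Commutant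

section Coefficient

open scoped ComplexOrder in
theorem Representation.character_inv_eq_star {G V : Type*} [Group G] [Fintype G] [AddCommGroup V]
    [Module ℂ V] [FiniteDimensional ℂ V] (ρ : Representation ℂ G V) (h : G) :
    ρ.character h⁻¹ = star (ρ.character h) := by
  let b := Module.finBasis ℂ V
  let M (g : G) := LinearMap.toMatrix b b (ρ g)
  have hM (g h : G) : M (g * h) = M g * M h := by
    simp only [M, map_mul]
    exact LinearMap.toMatrix_mul b _ _
  have hM1 : M 1 = 1 := by simp [M, LinearMap.toMatrix_one]
  have htr (g : G) : ρ.character g = (M g).trace := LinearMap.trace_eq_matrix_trace ℂ b (ρ g)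
  let Q := ∑ g, (M g).conjTranspose * M g
  have hQ : IsUnit Q := by
    refine Matrix.PosDef.isUnit ?_
    have h1 : Q = 1 + ∑ g ∈ Finset.univ.erase 1, (M g).conjTranspose * M g := by
      refine (Finset.add_sum_erase _ (fun g => (M g).conjTranspose * M g)
        (Finset.mem_univ (1 : G))).symm.trans ?_
      simp [hM1]
    rw [h1]
    exact Matrix.PosDef.one.add_posSemidef
      (Matrix.posSemidef_sum _ fun g _ => Matrix.posSemidef_conjTranspose_mul_self (M g))
  have hinv : (M h).conjTranspose * Q * M h = Q := by
    simp only [Q, Finset.mul_sum, Finset.sum_mul]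
    refine Fintype.sum_equiv (Equiv.mulRight h) _ _ fun g => ?_
    simp only [Equiv.coe_mulRight, hM, Matrix.conjTranspose_mul, Matrix.mul_assoc]
  have hstar : (M h).conjTranspose * Q = Q * M h⁻¹ := by
    nth_rewrite 2 [← hinv]
    rw [Matrix.mul_assoc _ (M h), ← hM, mul_inv_cancel, hM1, Matrix.mul_one]
  rw [htr, htr, ← Matrix.trace_conjTranspose]
  obtain ⟨u, hu⟩ := hQ
  rw [← hu] at hstar
  have h2 : (M h).conjTranspose =
      u.val * M h⁻¹ * (u⁻¹).val := by
    rw [← hstar, Matrix.mul_assoc, Units.mul_inv, Matrix.mul_one]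
  rw [h2, Matrix.trace_mul_comm, ← Matrix.mul_assoc, Units.inv_mul, Matrix.one_mul]

variable {Γ S : Type} [Group Γ] [Fintype Γ] {n : ℕ} (π : S → FDRep ℂ Γ) (ℓ : Fin n → S)

theorem coeff_eq_finrank (ρ : FDRep ℂ (stab ℓ)) :
    (Fintype.card (stab ℓ) : ℂ)⁻¹ * ∑ σ : stab ℓ, Mpi π ℓ σ * star (ρ.character σ) =
      Module.finrank ℂ (Representation.IntertwiningMap
        (ρ.ρ.comp (MonoidHom.fst (stab ℓ) Γ)) (stabDiagRep π ℓ)) := by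
  have : Invertible (Nat.card (stab ℓ × Γ) : ℂ) :=
    invertibleOfNonzero (Nat.cast_ne_zero.2 Nat.card_pos.ne')
  rw [← Representation.card_inv_mul_sum_char_mul_char_eq_finrank, Fintype.sum_prod_type,
    Nat.card_prod, Nat.card_eq_fintype_card, Nat.card_eq_fintype_card, Nat.cast_mul, mul_inv,
    mul_assoc]
  congr 1
  rw [Finset.mul_sum]
  refine Finset.sum_congr rfl fun σ _ => ?_
  rw [Mpi, mul_assoc, Finset.sum_mul]
  congr 1
  refine Finset.sum_congr rfl fun γ _ => ?_
  congr 1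
  exact (Representation.character_inv_eq_star ρ.ρ σ).symm

end Coefficient

section Reduction

/-- The convolution product without its normalising factor. -/
def convSum {G : Type*} [Group G] [Fintype G] (f₁ f₂ : G → ℂ) : G → ℂ :=
  fun x => ∑ y, f₁ (x * y⁻¹) * f₂ y

variable {Γ : Type} [Group Γ] {n : ℕ}

/-- Functions on `Γ^n` that are bi-invariant under the diagonal and symmetric in the factors. -/
structure IsDiagSymm (F : (Fin n → Γ) → ℂ) : Prop where
  diag : ∀ γ δ g, F ((fun _ => γ) * g * fun _ => δ) = F g
  perm : ∀ (σ : Equiv.Perm (Fin n)) g, F (g ∘ σ) = F g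

theorem IsBiinvariant.apply_eq {f : Gn Γ n → ℂ} (hf : IsBiinvariant (Kn Γ n) f) (x : Gn Γ n) :
    f x = f ⟨x.left, 1⟩ := by
  have h := hf 1 (one_mem _) ⟨1, x.right⟩ ⟨1, rfl⟩ ⟨x.left, 1⟩
  rw [← h]
  congr 1
  ext i <;> simp

theorem IsBiinvariant.isDiagSymm {f : Gn Γ n → ℂ} (hf : IsBiinvariant (Kn Γ n) f) :
    IsDiagSymm fun a => f ⟨a, 1⟩ where
  diag γ δ g := by
    rw [← hf ⟨fun _ => γ, 1⟩ ⟨γ, rfl⟩ ⟨fun _ => δ, 1⟩ ⟨δ, rfl⟩ ⟨g, 1⟩]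
    congr 1
  perm σ g := by
    rw [← hf ⟨1, σ⁻¹⟩ ⟨1, rfl⟩ ⟨1, σ⟩ ⟨1, rfl⟩ ⟨g, 1⟩]
    refine congrArg f (SemidirectProduct.ext ?_ (by simp))
    ext i
    simp only [SemidirectProduct.mul_left, map_one, one_mul, mul_one]
    rfl

theorem IsDiagSymm.isBiinvariant {F : (Fin n → Γ) → ℂ} (hF : IsDiagSymm F) :
    IsBiinvariant (Kn Γ n) fun x => F x.left := by
  rintro k₁ ⟨γ, h₁⟩ k₂ ⟨δ, h₂⟩ x
  change F _ = F x.left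
  rw [← hF.perm k₁.right.symm x.left, ← hF.diag γ δ (x.left ∘ _)]
  congr 1
  simp only [SemidirectProduct.mul_left, h₁, h₂]
  rfl

variable {S : Type} (π : S → FDRep ℂ Γ) (ℓ : Fin n → S)

theorem stabDiagRep_left (σ : stab ℓ) : stabDiagRep π ℓ (σ, 1) = permRep π ℓ σ := by
  change tensorRep π ℓ 1 ∘ₗ permRep π ℓ σ = _
  rw [map_one]
  rfl

theorem stabDiagRep_right (γ : Γ) : stabDiagRep π ℓ (1, γ) = tensorRep π ℓ fun _ => γ := by
  change _ ∘ₗ permRep π ℓ 1 = _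
  rw [map_one]
  rfl

variable [Fintype Γ]

theorem conv_eq_convSum {F₁ F₂ : (Fin n → Γ) → ℂ} (hF₂ : IsDiagSymm F₂) (x : Gn Γ n) :
    conv (fun y : Gn Γ n => F₁ y.left) (fun y => F₂ y.left) x =
      (Fintype.card (Gn Γ n) : ℂ)⁻¹ * (Fintype.card (Equiv.Perm (Fin n)) *
        convSum F₁ F₂ x.left) := by
  let e : (Fin n → Γ) × Equiv.Perm (Fin n) ≃ Gn Γ n :=
    { toFun := fun p => ⟨p.1, p.2⟩
      invFun := fun s => (s.left, s.right)
      left_inv := fun p => rfl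
      right_inv := fun s => rfl }
  rw [conv, ← e.sum_comp, Fintype.sum_prod_type_right]
  congr 1
  have h (τ : Equiv.Perm (Fin n)) :
      ∑ b, F₁ (x * (e (b, τ))⁻¹).left * F₂ (e (b, τ)).left = convSum F₁ F₂ x.left := by
    refine Fintype.sum_equiv ((x.right * τ⁻¹).arrowCongr (Equiv.refl Γ)) _ _ fun b => ?_
    have h₁ : (x * (e (b, τ))⁻¹).left =
        x.left * ((x.right * τ⁻¹).arrowCongr (Equiv.refl Γ) b)⁻¹ := rfl
    have h₂ : F₂ ((x.right * τ⁻¹).arrowCongr (Equiv.refl Γ) b) = F₂ (e (b, τ)).left :=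
      hF₂.perm (x.right * τ⁻¹).symm b
    rw [h₁, h₂]
  rw [Finset.sum_congr rfl fun τ _ => h τ]
  simp

theorem isGelfandPair_iff_convSum_comm :
    IsGelfandPair (Gn Γ n) (Kn Γ n) ↔ ∀ F₁ F₂ : (Fin n → Γ) → ℂ,
      IsDiagSymm F₁ → IsDiagSymm F₂ → convSum F₁ F₂ = convSum F₂ F₁ := by
  constructor
  · intro h F₁ F₂ hF₁ hF₂
    ext a
    have h' := congrFun (h _ _ hF₁.isBiinvariant hF₂.isBiinvariant) ⟨a, 1⟩
    rw [conv_eq_convSum hF₂, conv_eq_convSum hF₁] at h'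
    exact mul_left_cancel₀ (Nat.cast_ne_zero.2 Fintype.card_ne_zero)
      (mul_left_cancel₀ (inv_ne_zero (Nat.cast_ne_zero.2 Fintype.card_ne_zero)) h')
  · intro h f₁ f₂ hf₁ hf₂
    ext x
    rw [show f₁ = fun y => f₁ ⟨y.left, 1⟩ from funext hf₁.apply_eq,
      show f₂ = fun y => f₂ ⟨y.left, 1⟩ from funext hf₂.apply_eq,
      conv_eq_convSum (F₁ := fun a => f₁ ⟨a, 1⟩) hf₂.isDiagSymm,
      conv_eq_convSum (F₁ := fun a => f₂ ⟨a, 1⟩) hf₁.isDiagSymm,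
      h _ _ hf₁.isDiagSymm hf₂.isDiagSymm]

theorem fourierOp_convSum {G V : Type*} [Group G] [Fintype G] [AddCommGroup V] [Module ℂ V]
    (τ : Representation ℂ G V) (f₁ f₂ : G → ℂ) :
    fourierOp τ (convSum f₁ f₂) = fourierOp τ f₁ ∘ₗ fourierOp τ f₂ := by
  ext v
  simp only [fourierOp_apply, convSum, LinearMap.comp_apply, LinearMap.sum_apply,
    LinearMap.smul_apply, map_sum, map_smul, Finset.sum_smul, Finset.smul_sum]
  rw [Finset.sum_comm]
  refine Finset.sum_congr rfl fun y _ => ?_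
  refine Fintype.sum_equiv (Equiv.mulRight y⁻¹) _ _ fun x => ?_
  simp only [Equiv.coe_mulRight]
  rw [← Module.End.mul_apply (τ (x * y⁻¹)), ← map_mul, inv_mul_cancel_right, smul_smul, mul_comm]

theorem fourierOp_mul_mul {G V : Type*} [Group G] [Fintype G] [AddCommGroup V] [Module ℂ V]
    (τ : Representation ℂ G V) (f : G → ℂ) (x y : G) :
    fourierOp τ (fun g => f (x * g * y)) = τ x⁻¹ ∘ₗ fourierOp τ f ∘ₗ τ y⁻¹ := by
  ext v
  simp only [fourierOp_apply, LinearMap.comp_apply, LinearMap.sum_apply,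
    LinearMap.smul_apply, map_sum, map_smul]
  refine Fintype.sum_equiv ((Equiv.mulLeft x).trans (Equiv.mulRight y)) _ _ fun g => ?_
  simp only [Equiv.trans_apply, Equiv.coe_mulLeft, Equiv.coe_mulRight, ← Module.End.mul_apply,
    ← map_mul]
  congr 3
  group

theorem permRep_comp_fourierOp (σ : stab ℓ) (f : (Fin n → Γ) → ℂ) :
    permRep π ℓ σ⁻¹ ∘ₗ fourierOp (tensorRep π ℓ) (fun g => f (g ∘ σ.1)) =
      fourierOp (tensorRep π ℓ) f ∘ₗ permRep π ℓ σ⁻¹ := by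
  ext v
  simp only [fourierOp_apply, LinearMap.compMultilinearMap_apply, LinearMap.comp_apply,
    LinearMap.sum_apply, LinearMap.smul_apply, map_sum, map_smul]
  refine Fintype.sum_equiv (σ.1.symm.arrowCongr (Equiv.refl Γ)) _ _ fun g => ?_
  exact congrArg (f (g ∘ σ.1) • ·)
    (LinearMap.congr_fun (permRep_comp_tensorRep π ℓ σ⁻¹ g) (PiTensorProduct.tprod ℂ v))

theorem IsDiagSymm.isBiinvariantIntertwiner {F : (Fin n → Γ) → ℂ} (hF : IsDiagSymm F) :
    IsBiinvariantIntertwiner (stabDiagRep π ℓ) (fourierOp (tensorRep π ℓ) F) where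
  comm σ := by
    have h := permRep_comp_fourierOp π ℓ σ⁻¹ F
    simp only [hF.perm, inv_inv] at h
    rw [stabDiagRep_left, h]
  left_inv γ := by
    have h := fourierOp_mul_mul (tensorRep π ℓ) F (fun _ => γ⁻¹) (fun _ => 1)
    simp only [hF.diag] at h
    rw [stabDiagRep_right]
    nth_rewrite 2 [h]
    change _ = tensorRep π ℓ (fun _ => γ⁻¹)⁻¹ ∘ₗ fourierOp (tensorRep π ℓ) F ∘ₗ tensorRep π ℓ 1⁻¹
    rw [inv_one, map_one, Module.End.one_eq_id, LinearMap.comp_id]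
    simp [Pi.inv_def]
  right_inv γ := by
    have h := fourierOp_mul_mul (tensorRep π ℓ) F (fun _ => 1) (fun _ => γ⁻¹)
    simp only [hF.diag] at h
    rw [stabDiagRep_right]
    nth_rewrite 2 [h]
    change _ = tensorRep π ℓ 1⁻¹ ∘ₗ fourierOp (tensorRep π ℓ) F ∘ₗ tensorRep π ℓ (fun _ => γ⁻¹)⁻¹
    rw [inv_one, map_one, Module.End.one_eq_id, LinearMap.id_comp]
    simp [Pi.inv_def]

theorem isDiagSymm_sum (f : (Fin n → Γ) → ℂ) :
    IsDiagSymm fun g => ∑ σ : Equiv.Perm (Fin n), ∑ γ : Γ, ∑ δ : Γ,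
      f (((fun _ => γ) * g * fun _ => δ) ∘ σ) where
  diag γ' δ' g := by
    refine Finset.sum_congr rfl fun σ _ => ?_
    refine Fintype.sum_equiv (Equiv.mulRight γ') _ _ fun γ => ?_
    refine Fintype.sum_equiv (Equiv.mulLeft δ') _ _ fun δ => ?_
    congr 1
    ext i
    simp [mul_assoc]
  perm τ g := by
    refine Fintype.sum_equiv (Equiv.mulLeft τ) _ _ fun σ => ?_
    rfl

theorem exists_isDiagSymm_fourierOp_eq (hsimple : ∀ s, Simple (π s))
    (hdistinct : ∀ s t : S, Nonempty (π s ≅ π t) → s = t)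
    {A : (⨂[ℂ] i, (π (ℓ i) : Type)) →ₗ[ℂ] ⨂[ℂ] i, (π (ℓ i) : Type)}
    (hA : IsBiinvariantIntertwiner (stabDiagRep π ℓ) A) :
    ∃ (F : (Fin n → Γ) → ℂ) (c : ℂ), IsDiagSymm F ∧ c ≠ 0 ∧
      fourierOp (tensorRep π ℓ) F = c • A := by
  obtain ⟨f, hf, hf'⟩ := exists_fourierOp_tensorRep_eq π ℓ hsimple hdistinct A
  refine ⟨_, Fintype.card (stab ℓ) * (Fintype.card Γ * Fintype.card Γ), isDiagSymm_sum f, ?_, ?_⟩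
  · have h (T : Type) [Fintype T] [Nonempty T] : (Fintype.card T : ℂ) ≠ 0 :=
      Nat.cast_ne_zero.2 Fintype.card_ne_zero
    exact mul_ne_zero (h _) (mul_ne_zero (h _) (h _))
  have hσ (σ : Equiv.Perm (Fin n)) :
      fourierOp (tensorRep π ℓ) (fun g => f (g ∘ σ)) = if σ ∈ stab ℓ then A else 0 := by
    split_ifs with h
    · have h1 := permRep_comp_fourierOp π ℓ ⟨σ, h⟩ f
      have h2 := hA.comm (⟨σ, h⟩⁻¹ : stab ℓ)
      rw [stabDiagRep_left] at h2
      rw [hf, h2] at h1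
      have h3 := congrArg (fun X => permRep π ℓ ⟨σ, h⟩ * X) h1
      simpa only [← Module.End.mul_eq_comp, ← mul_assoc, ← map_mul, mul_inv_cancel, map_one,
        one_mul] using h3
    · exact hf' σ h
  have hL (γ : Γ) : tensorRep π ℓ (fun _ => γ) ∘ₗ A = A := by
    simpa only [stabDiagRep_right] using hA.left_inv γ
  have hR (γ : Γ) : A ∘ₗ tensorRep π ℓ (fun _ => γ) = A := by
    simpa only [stabDiagRep_right] using hA.right_inv γ
  have hterm (σ : Equiv.Perm (Fin n)) (γ δ : Γ) :
      fourierOp (tensorRep π ℓ) (fun g => f (((fun _ => γ) * g * fun _ => δ) ∘ σ)) =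
        if σ ∈ stab ℓ then A else 0 := by
    refine (fourierOp_mul_mul (tensorRep π ℓ) (fun g => f (g ∘ σ)) _ _).trans ?_
    rw [hσ]
    split_ifs
    · have := hR δ⁻¹
      have := hL γ⁻¹
      simp_all [Pi.inv_def]
    · simp
  have hsum : (fun g => ∑ σ : Equiv.Perm (Fin n), ∑ γ : Γ, ∑ δ : Γ,
      f (((fun _ => γ) * g * fun _ => δ) ∘ σ)) = ∑ σ : Equiv.Perm (Fin n), ∑ γ : Γ, ∑ δ : Γ,
      fun g => f (((fun _ => γ) * g * fun _ => δ) ∘ σ) := by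
    ext g
    simp
  rw [hsum]
  simp only [map_sum, hterm]
  simp only [Finset.sum_const, Finset.card_univ, ← Nat.cast_smul_eq_nsmul ℂ, smul_smul]
  rw [← Finset.smul_sum, Finset.sum_ite, Finset.sum_const_zero, add_zero, Finset.sum_const,
    ← Nat.cast_smul_eq_nsmul ℂ, smul_smul, mul_comm, Fintype.card_subtype]

theorem isGelfandPair_iff_commute (hsimple : ∀ s, Simple (π s))
    (hdistinct : ∀ s t : S, Nonempty (π s ≅ π t) → s = t)
    (hcomplete : ∀ τ : FDRep ℂ Γ, Simple τ → ∃ s, Nonempty (τ ≅ π s)) :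
    IsGelfandPair (Gn Γ n) (Kn Γ n) ↔ ∀ (ℓ : Fin n → S) (A B),
      IsBiinvariantIntertwiner (stabDiagRep π ℓ) A →
      IsBiinvariantIntertwiner (stabDiagRep π ℓ) B → A ∘ₗ B = B ∘ₗ A := by
  rw [isGelfandPair_iff_convSum_comm]
  constructor
  · intro h ℓ A B hA hB
    obtain ⟨F₁, c₁, hF₁, hc₁, hA'⟩ := exists_isDiagSymm_fourierOp_eq π ℓ hsimple hdistinct hA
    obtain ⟨F₂, c₂, hF₂, hc₂, hB'⟩ := exists_isDiagSymm_fourierOp_eq π ℓ hsimple hdistinct hB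
    have h1 := congrArg (fourierOp (tensorRep π ℓ)) (h F₁ F₂ hF₁ hF₂)
    rw [fourierOp_convSum, fourierOp_convSum, hA', hB'] at h1
    simp only [LinearMap.smul_comp, LinearMap.comp_smul, smul_smul] at h1
    rw [mul_comm c₂] at h1
    exact smul_right_injective _ (mul_ne_zero hc₁ hc₂) h1
  · intro h F₁ F₂ hF₁ hF₂
    rw [← sub_eq_zero]
    refine eq_zero_of_fourierOp_tensorRep_eq_zero π hcomplete _ fun ℓ => ?_
    rw [map_sub, fourierOp_convSum, fourierOp_convSum, sub_eq_zero]
    exact h ℓ _ _ (hF₁.isBiinvariantIntertwiner π ℓ) (hF₂.isBiinvariantIntertwiner π ℓ)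

end Reduction

/-- `(G_n, K_n)` is a Gelfand pair if and only if, for `{π_s}_{s : S}` a complete family of
pairwise non-isomorphic irreducible representations of `Γ`, every irreducible representation
`π = π_{ℓ1} ⊗̂ ⋯ ⊗̂ π_{ℓn}` of `Γ^n` and every irreducible representation `ρ` of `S_π` have
coefficient `⟨M_π, χ_ρ⟩_{S_π}` at most `1`. -/
theorem isGelfandPair_iff_Mpi_inner_char_le_one {Γ S : Type} [Group Γ] [Fintype Γ]
    (n : ℕ) (hn : 1 ≤ n)
    (π : S → FDRep ℂ Γ) (hsimple : ∀ s, Simple (π s))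
    (hdistinct : ∀ s t : S, Nonempty (π s ≅ π t) → s = t)
    (hcomplete : ∀ τ : FDRep ℂ Γ, Simple τ → ∃ s, Nonempty (τ ≅ π s)) :
    IsGelfandPair (Gn Γ n) (Kn Γ n) ↔
      ∀ (ℓ : Fin n → S) (ρ : FDRep ℂ (stab ℓ)), Simple ρ →
        ∃ m : ℕ, m ≤ 1 ∧
          (Fintype.card (stab ℓ) : ℂ)⁻¹ *
            ∑ σ : stab ℓ, Mpi π ℓ σ * star (ρ.character σ) = (m : ℂ) := by
  rw [isGelfandPair_iff_commute π hsimple hdistinct hcomplete]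
  refine forall_congr' fun ℓ => ?_
  simp only [coeff_eq_finrank, Nat.cast_inj, exists_eq_right']
  exact ⟨fun h ρ hρ => finrank_intertwiningMap_le_one_of_commute h ρ,
    fun h A B hA hB => commute_of_finrank_intertwiningMap_le_one h hA hB⟩
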